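/- The interval [0,1] is not a minimality detector for the square [0,1]²: there exists a sequence x̄ = (x_1,x_2,...) ∈ ([0,1]²)^ℕ that is not minimal such that for every continuous function f : [0,1]² → [0,1], the sequence (f(x_1),f(x_2),...) ∈ [0,1]^ℕ is minimal. In particular, [0,1] is not a universal minimality detector. -/

import Mathlib

open Set unitInterval

/-- The left shift `S` on sequences: `S(x₁,x₂,x₃,…) = (x₂,x₃,…)`. -/
def shiftSeq {X : Type*} (z : ℕ → X) : ℕ → X := fun n => z (n + 1)

/-- The closure of the forward shift-orbit `{z, Sz, S²z, …}` of a sequence `z`,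
inside the sequence space `ℕ → X`.  (For a compact metric space `X` the product
topology on `ℕ → X` is exactly the topology of the metric
`d̄(x̄,ȳ) = ∑ᵢ d(xᵢ,yᵢ)/2ⁱ`.) -/
def shiftOrbitClosure {X : Type*} [TopologicalSpace X] (z : ℕ → X) : Set (ℕ → X) :=
  closure (Set.range fun k => shiftSeq^[k] z)

/-- A sequence `z` is *minimal* if the closure of its shift-orbit is a minimal
dynamical system under the shift, i.e. every point of this closure has dense
forward orbit in it. -/
def IsMinimalSeq {X : Type*} [TopologicalSpace X] (z : ℕ → X) : Prop :=
  ∀ w ∈ shiftOrbitClosure z, shiftOrbitClosure z ⊆ shiftOrbitClosure w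

section Shift

variable {X : Type*}

theorem shiftSeq_iterate_apply (k : ℕ) (z : ℕ → X) (n : ℕ) :
    (shiftSeq^[k] z) n = z (n + k) := by
  induction k generalizing z with
  | zero => rfl
  | succ k ih =>
    rw [Function.iterate_succ_apply, ih]
    simp only [shiftSeq]
    congr 1

variable [TopologicalSpace X]

theorem continuous_shiftSeq : Continuous (shiftSeq : (ℕ → X) → ℕ → X) :=
  continuous_pi fun n => continuous_apply (n + 1)

theorem shiftSeq_iterate_mem_shiftOrbitClosure (k : ℕ) (z : ℕ → X) :
    shiftSeq^[k] z ∈ shiftOrbitClosure z :=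
  subset_closure ⟨k, rfl⟩

theorem shiftOrbitClosure_subset {w z : ℕ → X} (h : w ∈ shiftOrbitClosure z) :
    shiftOrbitClosure w ⊆ shiftOrbitClosure z := by
  refine closure_minimal ?_ isClosed_closure
  rintro _ ⟨k, rfl⟩
  refine (continuous_shiftSeq.iterate k).closure_preimage_subset _ ?_
  refine closure_mono ?_ h
  rintro _ ⟨j, rfl⟩
  exact ⟨k + j, Function.iterate_add_apply _ _ _ _⟩

theorem IsMinimalSeq.of_mem {w z : ℕ → X} (hz : IsMinimalSeq z)
    (hw : w ∈ shiftOrbitClosure z) : IsMinimalSeq w := fun _ hv =>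
  (shiftOrbitClosure_subset hw).trans (hz _ (shiftOrbitClosure_subset hw hv))

theorem comp_mem_shiftOrbitClosure {Y : Type*} [TopologicalSpace Y] {f : X → Y}
    (hf : Continuous f) {w z : ℕ → X} (hw : w ∈ shiftOrbitClosure z) :
    f ∘ w ∈ shiftOrbitClosure (f ∘ z) := by
  have hF : Continuous fun v : ℕ → X => f ∘ v :=
    continuous_pi fun n => hf.comp (continuous_apply n)
  refine hF.closure_preimage_subset _ (closure_mono ?_ hw)
  rintro _ ⟨k, rfl⟩
  refine ⟨k, funext fun n => ?_⟩
  simp [shiftSeq_iterate_apply]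

end Shift

/-- A sequence is Toeplitz if each of its initial segments recurs periodically. -/
def IsToeplitzSeq {X : Type*} (z : ℕ → X) : Prop :=
  ∀ N, ∃ p, 0 < p ∧ ∀ n < N, ∀ k, z (n + k * p) = z n

theorem IsToeplitzSeq.comp {X Y : Type*} {z : ℕ → X} (hz : IsToeplitzSeq z) (f : X → Y) :
    IsToeplitzSeq (f ∘ z) := fun N => by
  obtain ⟨p, hp, h⟩ := hz N
  exact ⟨p, hp, fun n hn k => congrArg f (h n hn k)⟩

theorem IsToeplitzSeq.isMinimalSeq {X : Type*} [TopologicalSpace X] [T1Space X] {z : ℕ → X}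
    (hz : IsToeplitzSeq z) : IsMinimalSeq z := by
  intro w hw
  refine shiftOrbitClosure_subset ?_
  have key : ∀ N, ∃ m, ∀ n < N, w (n + m) = z n := by
    intro N
    obtain ⟨p, hp, h⟩ := hz N
    have hclosed : IsClosed (⋃ m ∈ Finset.range p, {v : ℕ → X | ∀ n < N, v (n + m) = z n}) := by
      refine isClosed_biUnion_finset fun m _ => ?_
      simp only [Set.ofPred_forall]
      exact isClosed_iInter fun n => isClosed_iInter fun _ =>
        isClosed_singleton.preimage (continuous_apply (n + m))
    have hsub := closure_minimal (s := Set.range fun k => shiftSeq^[k] z) ?_ hclosed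
    · have := hsub hw
      simp only [Set.mem_iUnion] at this
      obtain ⟨m, -, hm⟩ := this
      exact ⟨m, hm⟩
    · rintro _ ⟨k, rfl⟩
      simp only [Set.mem_iUnion, Finset.mem_range]
      obtain ⟨m, hm, q, hq⟩ : ∃ m < p, ∃ q, m + k = q * p := by
        rcases Nat.eq_zero_or_pos (k % p) with h0 | h0
        · exact ⟨0, hp, k / p, by have := Nat.div_add_mod' k p; omega⟩
        · refine ⟨p - k % p, by omega, k / p + 1, ?_⟩
          have := Nat.div_add_mod' k p
          have := Nat.mod_lt k hp
          rw [Nat.add_mul]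
          omega
      refine ⟨m, hm, fun n hn => ?_⟩
      rw [shiftSeq_iterate_apply, Nat.add_assoc, hq, h n hn]
  choose m hm using key
  refine mem_closure_of_tendsto (f := fun N => shiftSeq^[m N] w) (b := Filter.atTop) ?_
    (Filter.Eventually.of_forall fun N => ⟨m N, rfl⟩)
  refine tendsto_pi_nhds.2 fun n => tendsto_const_nhds.congr' ?_
  filter_upwards [Filter.eventually_gt_atTop n] with N hN
  rw [shiftSeq_iterate_apply, hm N n hN]

theorem padicValNat_two_add_mul_two_pow {n N : ℕ} (hn : 0 < n) (hN : n < 2 ^ N) (k : ℕ) :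
    padicValNat 2 (n + k * 2 ^ N) = padicValNat 2 n := by
  have hlt : padicValNat 2 n < N :=
    (Nat.pow_lt_pow_iff_right one_lt_two).1
      ((Nat.le_of_dvd hn pow_padicValNat_dvd).trans_lt hN)
  have hne : n + k * 2 ^ N ≠ 0 := by omega
  refine le_antisymm ?_ ?_
  · by_contra! hlt'
    have h1 : 2 ^ (padicValNat 2 n + 1) ∣ n + k * 2 ^ N :=
      (padicValNat_dvd_iff_le hne).2 hlt'
    have h2 : 2 ^ (padicValNat 2 n + 1) ∣ k * 2 ^ N :=
      Dvd.dvd.mul_left (pow_dvd_pow 2 hlt) k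
    exact pow_succ_padicValNat_not_dvd hn.ne' ((Nat.dvd_add_left h2).1 h1)
  · exact (padicValNat_dvd_iff_le hne).1
      (dvd_add pow_padicValNat_dvd (Dvd.dvd.mul_left (pow_dvd_pow 2 hlt.le) k))

/-- Prepend a block of three letters to a sequence. -/
def prependTriple {X : Type*} (b : Fin 3 → X) (z : ℕ → X) : ℕ → X := fun n =>
  if h : n < 3 then b ⟨n, h⟩ else z (n - 3)

/-- The concatenation of blocks of length three in which the `n`-th block (counted from one)
is `a (v₂ n)`, where `v₂` is the `2`-adic valuation. -/
def dyadicToeplitz {X : Type*} (a : ℕ → Fin 3 → X) : ℕ → X := fun n =>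
  a (padicValNat 2 (n / 3 + 1)) ⟨n % 3, Nat.mod_lt n three_pos⟩

theorem dyadicToeplitz_block {X : Type*} (a : ℕ → Fin 3 → X) (m : ℕ) (j : Fin 3) :
    dyadicToeplitz a (3 * m + j) = a (padicValNat 2 (m + 1)) j := by
  have hdiv : (3 * m + (j : ℕ)) / 3 = m := by omega
  have hmod : (3 * m + (j : ℕ)) % 3 = j := by omega
  simp only [dyadicToeplitz, hdiv, hmod]

theorem shiftSeq_iterate_prependTriple {X : Type*} (b : Fin 3 → X) (z : ℕ → X) :
    shiftSeq^[3] (prependTriple b z) = z := by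
  funext n
  simp [shiftSeq_iterate_apply, prependTriple]

theorem dyadicToeplitz_isToeplitzSeq {X : Type*} (a : ℕ → Fin 3 → X) :
    IsToeplitzSeq (dyadicToeplitz a) := by
  intro N
  refine ⟨3 * 2 ^ N, by positivity, fun n hn k => ?_⟩
  have hN := Nat.lt_two_pow_self (n := N)
  have h1 : (n + k * (3 * 2 ^ N)) / 3 + 1 = (n / 3 + 1) + k * 2 ^ N := by
    rw [show n + k * (3 * 2 ^ N) = n + 3 * (k * 2 ^ N) by ring]
    omega
  have h2 : (n + k * (3 * 2 ^ N)) % 3 = n % 3 := by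
    rw [show n + k * (3 * 2 ^ N) = n + 3 * (k * 2 ^ N) by ring]
    omega
  simp only [dyadicToeplitz, h1, h2]
  rw [padicValNat_two_add_mul_two_pow (by omega) (by omega)]

theorem prependTriple_mem_shiftOrbitClosure {X : Type*} [TopologicalSpace X]
    {a : ℕ → Fin 3 → X} {b : Fin 3 → X} (hb : ∃ᶠ k in Filter.atTop, a k = b) :
    prependTriple b (dyadicToeplitz a) ∈ shiftOrbitClosure (dyadicToeplitz a) := by
  obtain ⟨φ, hφ, hφb⟩ := Filter.extraction_of_frequently_atTop hb
  refine mem_closure_of_tendsto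
    (f := fun N => shiftSeq^[3 * (2 ^ φ N - 1)] (dyadicToeplitz a)) (b := Filter.atTop) ?_
    (Filter.Eventually.of_forall fun N => ⟨_, rfl⟩)
  refine tendsto_pi_nhds.2 fun n => tendsto_const_nhds.congr' ?_
  filter_upwards [Filter.eventually_gt_atTop n] with N hN
  have hlt : n < 2 ^ φ N :=
    hN.trans_le ((hφ.id_le N).trans (Nat.lt_two_pow_self).le)
  have hdiv : (n + 3 * (2 ^ φ N - 1)) / 3 + 1 = n / 3 + 1 * 2 ^ φ N := by omega
  have hmod : (n + 3 * (2 ^ φ N - 1)) % 3 = n % 3 := by omega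
  simp only [shiftSeq_iterate_apply, dyadicToeplitz, prependTriple, hdiv, hmod]
  split_ifs with h
  · have h0 : n / 3 = 0 := by omega
    simp only [h0, Nat.zero_add, one_mul, padicValNat.prime_pow, hφb, Nat.mod_eq_of_lt h]
  · have h0 : (n - 3) / 3 + 1 = n / 3 := by omega
    have h1 : (n - 3) % 3 = n % 3 := by omega
    rw [padicValNat_two_add_mul_two_pow (by omega) (by omega)]
    simp only [h0, h1]

/-- The vertices of a triangle in the unit square. -/
def triangleVertex : Fin 3 → I × I := ![(0, 0), (1, 0), (0, 1)]

/-- The side of the triangle opposite to the given vertex. -/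
def triangleSide : Fin 3 → I → I × I :=
  ![fun t => (t, σ t), fun t => (0, t), fun t => (t, 0)]

/-- The triple of vertices of the triangle with the `i`-th one replaced by a point of the
opposite side. -/
def perturbedTriple (q : Fin 3 × I) : Fin 3 → I × I :=
  Function.update triangleVertex q.1 (triangleSide q.1 q.2)

theorem continuous_triangleSide (i : Fin 3) : Continuous (triangleSide i) := by
  fin_cases i <;> simp only [triangleSide] <;> dsimp <;> fun_prop

theorem continuous_perturbedTriple : Continuous perturbedTriple := by
  rw [continuous_prod_of_discrete_left]
  exact fun i => continuous_const.update i (continuous_triangleSide i)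

theorem exists_comp_perturbedTriple_eq {f : I × I → I} (hf : Continuous f) :
    ∃ q, f ∘ perturbedTriple q = f ∘ triangleVertex := by
  suffices ∃ i t, f (triangleSide i t) = f (triangleVertex i) by
    obtain ⟨i, t, h⟩ := this
    refine ⟨(i, t), funext fun j => ?_⟩
    by_cases hj : j = i
    · subst hj; simpa [perturbedTriple] using h
    · simp [perturbedTriple, hj]
  have ivt : ∀ i, f (triangleVertex i) ∈
      Set.uIcc (f (triangleSide i 0)) (f (triangleSide i 1)) →
      ∃ i t, f (triangleSide i t) = f (triangleVertex i) := fun i hi => by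
    obtain ⟨t, -, ht⟩ := intermediate_value_uIcc
      (hf.comp (continuous_triangleSide i)).continuousOn hi
    exact ⟨i, t, ht⟩
  have h0 := ivt 0
  have h1 := ivt 1
  have h2 := ivt 2
  simp only [triangleVertex, triangleSide, Set.mem_uIcc, Matrix.cons_val, symm_zero,
    symm_one] at h0 h1 h2
  have h01 := le_total (f (0, 0)) (f (1, 0))
  have h02 := le_total (f (0, 0)) (f (0, 1))
  have h12 := le_total (f (1, 0)) (f (0, 1))
  tauto

/-- Sequences at least one of whose first three terms lies on the side opposite to the
corresponding vertex of the triangle. -/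
def incidentTriples : Set (ℕ → I × I) :=
  {y | (y 0).2 = σ (y 0).1 ∨ (y 1).1 = 0 ∨ (y 2).2 = 0}

theorem isClosed_incidentTriples : IsClosed incidentTriples := by
  refine IsClosed.union ?_ (IsClosed.union ?_ ?_)
  · exact isClosed_eq (by fun_prop) (by fun_prop)
  · exact isClosed_eq (by fun_prop) (by fun_prop)
  · exact isClosed_eq (by fun_prop) (by fun_prop)

theorem prependTriple_triangleVertex_notMem (z : ℕ → I × I) :
    prependTriple triangleVertex z ∉ incidentTriples := by
  simp [incidentTriples, prependTriple, triangleVertex]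

theorem shiftSeq_iterate_dyadicToeplitz_mem (d : ℕ → Fin 3 × I) (k : ℕ) :
    shiftSeq^[k] (dyadicToeplitz fun n => perturbedTriple (d n)) ∈ incidentTriples := by
  rw [incidentTriples, Set.mem_ofPred_eq]
  simp only [shiftSeq_iterate_apply]
  obtain ⟨m, rfl | rfl | rfl⟩ : ∃ m, k = 3 * m ∨ k = 3 * m + 1 ∨ k = 3 * m + 2 :=
    ⟨k / 3, by omega⟩
  · rw [show 0 + 3 * m = 3 * m + (0 : Fin 3) by simp,
      show 1 + 3 * m = 3 * m + (1 : Fin 3) by simp [add_comm],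
      show 2 + 3 * m = 3 * m + (2 : Fin 3) by simp [add_comm]]
    simp only [dyadicToeplitz_block]
    obtain ⟨i, t⟩ := d (padicValNat 2 (m + 1))
    fin_cases i <;> simp [perturbedTriple, triangleSide, triangleVertex]
  · rw [show 0 + (3 * m + 1) = 3 * m + (1 : Fin 3) by simp,
      show 1 + (3 * m + 1) = 3 * m + (2 : Fin 3) by simp; omega]
    simp only [dyadicToeplitz_block]
    obtain ⟨i, t⟩ := d (padicValNat 2 (m + 1))
    fin_cases i <;> simp [perturbedTriple, triangleSide, triangleVertex]
  · rw [show 0 + (3 * m + 2) = 3 * m + (2 : Fin 3) by simp,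
      show 1 + (3 * m + 2) = 3 * (m + 1) + (0 : Fin 3) by simp; omega,
      show 2 + (3 * m + 2) = 3 * (m + 1) + (1 : Fin 3) by simp; omega]
    simp only [dyadicToeplitz_block]
    obtain ⟨i, t⟩ := d (padicValNat 2 (m + 1))
    obtain ⟨j, s⟩ := d (padicValNat 2 (m + 1 + 1))
    fin_cases i <;> fin_cases j <;> simp [perturbedTriple, triangleSide, triangleVertex]

/-- `[0,1]` is not a minimality detector for `[0,1]²`: there is a non-minimal
sequence in `([0,1]²)ᴺ` whose image under every continuous `f : [0,1]² → [0,1]`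
is minimal. -/
theorem unitInterval_not_minimality_detector_for_unitSquare :
    ∃ x : ℕ → I × I, ¬ IsMinimalSeq x ∧
      ∀ f : I × I → I, Continuous f → IsMinimalSeq (fun n => f (x n)) := by
  let d : ℕ → Fin 3 × I := fun n => TopologicalSpace.denseSeq (Fin 3 × I) n.unpair.1
  let z : ℕ → I × I := dyadicToeplitz fun n => perturbedTriple (d n)
  have hz : IsToeplitzSeq z := dyadicToeplitz_isToeplitzSeq _
  have hmem : ∀ q, prependTriple (perturbedTriple q) z ∈ shiftOrbitClosure z := by
    have hcont : Continuous fun q => prependTriple (perturbedTriple q) z := by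
      refine continuous_pi fun n => ?_
      unfold prependTriple
      split_ifs with h
      · exact (continuous_apply _).comp continuous_perturbedTriple
      · exact continuous_const
    intro q
    refine closure_minimal (s := Set.range (TopologicalSpace.denseSeq (Fin 3 × I))) ?_
      (IsClosed.preimage hcont isClosed_closure)
      (TopologicalSpace.denseRange_denseSeq (Fin 3 × I) q)
    rintro _ ⟨m, rfl⟩
    refine prependTriple_mem_shiftOrbitClosure (Filter.frequently_atTop.2 fun l => ?_)
    exact ⟨Nat.pair m l, Nat.right_le_pair m l, by simp [d]⟩
  refine ⟨prependTriple triangleVertex z, fun hmin => ?_, fun f hf => ?_⟩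
  · have hzx : z ∈ shiftOrbitClosure (prependTriple triangleVertex z) := by
      simpa only [shiftSeq_iterate_prependTriple] using
        shiftSeq_iterate_mem_shiftOrbitClosure 3 (prependTriple triangleVertex z)
    have hxz := hmin z hzx (shiftSeq_iterate_mem_shiftOrbitClosure 0 _)
    refine prependTriple_triangleVertex_notMem z
      (closure_minimal ?_ isClosed_incidentTriples hxz)
    rintro _ ⟨k, rfl⟩
    exact shiftSeq_iterate_dyadicToeplitz_mem d k
  · obtain ⟨q, hq⟩ := exists_comp_perturbedTriple_eq hf
    have heq : (fun n => f (prependTriple triangleVertex z n)) =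
        f ∘ prependTriple (perturbedTriple q) z := by
      funext n
      simp only [Function.comp_apply, prependTriple]
      split_ifs with h
      · exact (congrFun hq ⟨n, h⟩).symm
      · rfl
    rw [heq]
    exact (hz.comp f).isMinimalSeq.of_mem (comp_mem_shiftOrbitClosure hf (hmem q))
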